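/- Let 1 ≤ p < ∞ and t ∈ (0,1). The generalized Cesàro operator C_t maps H^p continuously into itself, and its operator norm satisfies 1 ≤ ‖C_t‖_{H^p→H^p} ≤ 1/(1−t). -/

import Mathlib

open Complex MeasureTheory Metric Set Filter Topology

/-- The generalized Cesàro operator `C_t`, given by
`(C_t f)(z) = ∫_0^1 f(sz)/(1 - s t z) ds`, which equals `f(0)` at `z = 0` and
`(1/z)∫_0^z f(ξ)/(1 - tξ) dξ` for `z ≠ 0`. -/
noncomputable def cesaro (t : ℝ) (f : ℂ → ℂ) (z : ℂ) : ℂ :=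
  ∫ s in (0:ℝ)..1, f ((s : ℂ) * z) / (1 - (s : ℂ) * (t : ℂ) * z)

/-- The integral means `M_p(r, f)`. -/
noncomputable def Mp (p : ℝ) (r : ℝ) (f : ℂ → ℂ) : ℝ :=
  ((1 / (2 * Real.pi)) *
    ∫ θ in (0:ℝ)..(2 * Real.pi), ‖f ((r : ℂ) * Complex.exp ((θ : ℂ) * Complex.I))‖ ^ p) ^ (1 / p)

/-- The Hardy space norm `‖f‖_p = sup_{0 ≤ r < 1} M_p(r, f)`. -/
noncomputable def hardyNorm (p : ℝ) (f : ℂ → ℂ) : ℝ :=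
  sSup ((fun r => Mp p r f) '' Set.Ico (0:ℝ) 1)

/-- Membership in the Hardy space `H^p`: holomorphic on the unit disc with bounded
integral means. -/
def MemHp (p : ℝ) (f : ℂ → ℂ) : Prop :=
  DifferentiableOn ℂ f (Metric.ball (0:ℂ) 1) ∧
    BddAbove ((fun r => Mp p r f) '' Set.Ico (0:ℝ) 1)

theorem ofReal_mul_mem_ball {s : ℝ} (hs : s ∈ Icc (0:ℝ) 1) {z : ℂ} (hz : z ∈ ball (0:ℂ) 1) :
    (s : ℂ) * z ∈ ball (0:ℂ) 1 := by
  rw [mem_ball_zero_iff] at hz ⊢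
  rw [norm_mul, Complex.norm_real, Real.norm_of_nonneg hs.1]
  nlinarith [hs.1, hs.2, norm_nonneg z]

theorem mul_exp_mem_ball {r : ℝ} (hr : r ∈ Ico (0:ℝ) 1) (θ : ℝ) :
    (r : ℂ) * exp ((θ : ℂ) * I) ∈ ball (0:ℂ) 1 := by
  rw [mem_ball_zero_iff, norm_mul, norm_exp_ofReal_mul_I, Complex.norm_real,
    Real.norm_of_nonneg hr.1, mul_one]
  exact hr.2

theorem one_sub_le_norm_one_sub_mul {t : ℝ} (ht : 0 ≤ t) {z : ℂ} (hz : z ∈ ball (0:ℂ) 1) :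
    1 - t ≤ ‖1 - (t : ℂ) * z‖ := by
  rw [mem_ball_zero_iff] at hz
  have h := norm_sub_norm_le (1 : ℂ) ((t : ℂ) * z)
  rw [norm_one, norm_mul, Complex.norm_real, Real.norm_of_nonneg ht] at h
  nlinarith

theorem differentiableOn_div_one_sub_mul {t : ℝ} (ht0 : 0 ≤ t) (ht1 : t < 1) {f : ℂ → ℂ}
    (hf : DifferentiableOn ℂ f (ball (0:ℂ) 1)) :
    DifferentiableOn ℂ (fun w => f w / (1 - (t : ℂ) * w)) (ball (0:ℂ) 1) := by
  refine hf.div (by fun_prop) fun w hw => norm_pos_iff.mp ?_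
  linarith [one_sub_le_norm_one_sub_mul ht0 hw]

theorem cesaro_eq (t : ℝ) (f : ℂ → ℂ) (z : ℂ) :
    cesaro t f z =
      ∫ s in (0:ℝ)..1, (fun w => f w / (1 - (t : ℂ) * w)) ((s : ℂ) * z) := by
  unfold cesaro
  congr 1
  ext s
  simp only
  congr 2
  ring

theorem continuousOn_comp_ofReal_mul {h : ℂ → ℂ} (hh : ContinuousOn h (ball (0:ℂ) 1)) {z : ℂ}
    (hz : z ∈ ball (0:ℂ) 1) : ContinuousOn (fun s : ℝ => h ((s : ℂ) * z)) (Icc (0:ℝ) 1) :=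
  hh.comp (by fun_prop) fun _ hs => ofReal_mul_mem_ball hs hz

/-- Radial averages of a holomorphic function are holomorphic. -/
theorem differentiableOn_integral_ofReal_mul {h : ℂ → ℂ}
    (hh : DifferentiableOn ℂ h (ball (0:ℂ) 1)) :
    DifferentiableOn ℂ (fun z => ∫ s in (0:ℝ)..1, h ((s : ℂ) * z)) (ball (0:ℂ) 1) := by
  obtain ⟨g, hg⟩ := hh.isExactOn_ball
  have hgd : DifferentiableOn ℂ (dslope g 0) (ball (0:ℂ) 1) :=
    (differentiableOn_dslope (ball_mem_nhds 0 one_pos)).mpr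
      fun z hz => (hg z hz).differentiableAt.differentiableWithinAt
  refine hgd.congr fun z hz => ?_
  rcases eq_or_ne z 0 with rfl | hz0
  · simp [dslope_same, (hg 0 (mem_ball_self one_pos)).deriv]
  · have hI := intervalIntegral.integral_eq_sub_of_hasDerivAt (a := 0) (b := 1)
      (f := fun s : ℝ => g ((s : ℂ) * z)) (f' := fun s : ℝ => h ((s : ℂ) * z) * z)
      (fun s hs => by
        rw [uIcc_of_le zero_le_one] at hs
        have h1 : HasDerivAt (fun w : ℂ => w * z) z (s : ℂ) := by
          simpa using (hasDerivAt_id (s : ℂ)).mul_const z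
        have h2 := hg _ (ofReal_mul_mem_ball hs hz)
        exact (HasDerivAt.comp (s : ℂ) h2 h1).comp_ofReal)
      (ContinuousOn.intervalIntegrable (by
        rw [uIcc_of_le zero_le_one]
        exact (continuousOn_comp_ofReal_mul hh.continuousOn hz).mul continuousOn_const))
    rw [intervalIntegral.integral_mul_const] at hI
    rw [dslope_of_ne _ hz0, slope_def_field, eq_div_iff (by simpa using hz0)]
    simpa using hI

theorem differentiableOn_cesaro {t : ℝ} (ht0 : 0 ≤ t) (ht1 : t < 1) {f : ℂ → ℂ}
    (hf : DifferentiableOn ℂ f (ball (0:ℂ) 1)) :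
    DifferentiableOn ℂ (cesaro t f) (ball (0:ℂ) 1) :=
  (differentiableOn_integral_ofReal_mul (differentiableOn_div_one_sub_mul ht0 ht1 hf)).congr
    fun z _ => cesaro_eq t f z

/-- Jensen's inequality on the unit interval. -/
theorem rpow_integral_le_integral_rpow {p : ℝ} (hp : 1 ≤ p) {u : ℝ → ℝ}
    (hu : ContinuousOn u (Icc (0:ℝ) 1)) (hu0 : ∀ s ∈ Icc (0:ℝ) 1, 0 ≤ u s) :
    (∫ s in (0:ℝ)..1, u s) ^ p ≤ ∫ s in (0:ℝ)..1, u s ^ p := by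
  rw [intervalIntegral.integral_of_le zero_le_one, intervalIntegral.integral_of_le zero_le_one]
  have : IsProbabilityMeasure (volume.restrict (Ioc (0:ℝ) 1)) := ⟨by simp⟩
  have hpow : ContinuousOn (fun s => u s ^ p) (Icc (0:ℝ) 1) :=
    hu.rpow_const fun _ _ => Or.inr (by linarith)
  refine ConvexOn.map_integral_le (convexOn_rpow hp)
    (continuousOn_id.rpow_const fun _ _ => Or.inr (by linarith)) isClosed_Ici ?_ ?_ ?_
  · filter_upwards [ae_restrict_mem measurableSet_Ioc] with s hs
    exact hu0 s (Ioc_subset_Icc_self hs)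
  · exact (hu.integrableOn_Icc).mono_set Ioc_subset_Icc_self
  · exact (hpow.integrableOn_Icc).mono_set Ioc_subset_Icc_self

theorem norm_cesaro_rpow_le {p t : ℝ} (hp : 1 ≤ p) (ht0 : 0 ≤ t) (ht1 : t < 1) {f : ℂ → ℂ}
    (hf : ContinuousOn f (ball (0:ℂ) 1)) {z : ℂ} (hz : z ∈ ball (0:ℂ) 1) :
    ‖cesaro t f z‖ ^ p ≤
      (1 / (1 - t)) ^ p * ∫ s in (0:ℝ)..1, ‖f ((s : ℂ) * z)‖ ^ p := by
  have h1t : 0 < 1 - t := by linarith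
  have hfc : ContinuousOn (fun s : ℝ => ‖f ((s : ℂ) * z)‖) (Icc (0:ℝ) 1) :=
    (continuousOn_comp_ofReal_mul hf hz).norm
  have hle : ‖cesaro t f z‖ ≤ (1 / (1 - t)) * ∫ s in (0:ℝ)..1, ‖f ((s : ℂ) * z)‖ := by
    rw [cesaro_eq, ← intervalIntegral.integral_const_mul]
    refine intervalIntegral.norm_integral_le_of_norm_le zero_le_one ?_ ?_
    · refine Eventually.of_forall fun s hs => ?_
      rw [norm_div, div_eq_inv_mul, one_div]
      gcongr
      exact one_sub_le_norm_one_sub_mul ht0 (ofReal_mul_mem_ball (Ioc_subset_Icc_self hs) hz)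
    · refine ContinuousOn.intervalIntegrable ?_
      rw [uIcc_of_le zero_le_one]
      exact continuousOn_const.mul hfc
  have hI0 : 0 ≤ ∫ s in (0:ℝ)..1, ‖f ((s : ℂ) * z)‖ :=
    intervalIntegral.integral_nonneg zero_le_one fun _ _ => norm_nonneg _
  calc ‖cesaro t f z‖ ^ p
      ≤ ((1 / (1 - t)) * ∫ s in (0:ℝ)..1, ‖f ((s : ℂ) * z)‖) ^ p := by gcongr
    _ = (1 / (1 - t)) ^ p * (∫ s in (0:ℝ)..1, ‖f ((s : ℂ) * z)‖) ^ p :=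
        Real.mul_rpow (by positivity) hI0
    _ ≤ _ := by
        gcongr
        exact rpow_integral_le_integral_rpow hp hfc fun _ _ => norm_nonneg _

theorem circleMean_nonneg (p r : ℝ) (f : ℂ → ℂ) :
    0 ≤ (1 / (2 * Real.pi)) *
      ∫ θ in (0:ℝ)..(2 * Real.pi), ‖f ((r : ℂ) * exp ((θ : ℂ) * I))‖ ^ p :=
  mul_nonneg (by positivity)
    (intervalIntegral.integral_nonneg (by positivity) fun _ _ => by positivity)

theorem Mp_nonneg (p r : ℝ) (f : ℂ → ℂ) : 0 ≤ Mp p r f :=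
  Real.rpow_nonneg (circleMean_nonneg p r f) _

theorem Mp_le_iff {p : ℝ} (hp : 0 < p) (r : ℝ) (f : ℂ → ℂ) {M : ℝ} (hM : 0 ≤ M) :
    Mp p r f ≤ M ↔
      ∫ θ in (0:ℝ)..(2 * Real.pi), ‖f ((r : ℂ) * exp ((θ : ℂ) * I))‖ ^ p ≤
        2 * Real.pi * M ^ p := by
  rw [Mp, one_div p, Real.rpow_inv_le_iff_of_pos (circleMean_nonneg p r f) hM hp, one_div,
    inv_mul_le_iff₀ (by positivity)]

theorem Mp_le_hardyNorm {p : ℝ} {f : ℂ → ℂ} (hf : MemHp p f) {r : ℝ} (hr : r ∈ Ico (0:ℝ) 1) :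
    Mp p r f ≤ hardyNorm p f :=
  le_csSup hf.2 (mem_image_of_mem _ hr)

theorem Mp_cesaro_le {p t : ℝ} (hp : 1 ≤ p) (ht0 : 0 ≤ t) (ht1 : t < 1) {f : ℂ → ℂ}
    (hf : ContinuousOn f (ball (0:ℂ) 1)) {M : ℝ} (hM : ∀ r ∈ Ico (0:ℝ) 1, Mp p r f ≤ M)
    {r : ℝ} (hr : r ∈ Ico (0:ℝ) 1) :
    Mp p r (cesaro t f) ≤ (1 / (1 - t)) * M := by
  have hp0 : 0 < p := by linarith
  have h1t : 0 < 1 - t := by linarith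
  have hM0 : 0 ≤ M := (Mp_nonneg p r f).trans (hM r hr)
  rw [Mp_le_iff hp0 _ _ (by positivity), Real.mul_rpow (by positivity) hM0]
  let F : ℝ → ℝ → ℝ := fun θ s => ‖f ((s : ℂ) * ((r : ℂ) * exp ((θ : ℂ) * I)))‖ ^ p
  have hFc : ContinuousOn (Function.uncurry F)
      (Icc (0:ℝ) (2 * Real.pi) ×ˢ Icc (0:ℝ) 1) := by
    refine ContinuousOn.rpow_const (ContinuousOn.norm (hf.comp (by fun_prop) ?_))
      fun _ _ => Or.inr hp0.le
    exact fun x hx => ofReal_mul_mem_ball hx.2 (mul_exp_mem_ball hr x.1)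
  have hFi : Integrable (Function.uncurry F) ((volume.restrict (Ioc 0 (2 * Real.pi))).prod
      (volume.restrict (Ioc 0 1))) := by
    rw [Measure.prod_restrict]
    exact (hFc.integrableOn_compact (isCompact_Icc.prod isCompact_Icc)).mono_set
      (prod_mono Ioc_subset_Icc_self Ioc_subset_Icc_self)
  have hmean : ∀ s ∈ Ioc (0:ℝ) 1, ∫ θ in Ioc 0 (2 * Real.pi), F θ s ≤
      2 * Real.pi * M ^ p := by
    intro s hs
    have hsr : s * r ∈ Ico (0:ℝ) 1 :=
      ⟨mul_nonneg hs.1.le hr.1, (mul_le_of_le_one_left hr.1 hs.2).trans_lt hr.2⟩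
    have h := (Mp_le_iff hp0 _ _ hM0).mp (hM _ hsr)
    rw [intervalIntegral.integral_of_le (by positivity)] at h
    simpa [F, mul_assoc] using h
  rw [intervalIntegral.integral_of_le (by positivity)]
  calc ∫ θ in Ioc 0 (2 * Real.pi), ‖cesaro t f ((r : ℂ) * exp ((θ : ℂ) * I))‖ ^ p
      ≤ ∫ θ in Ioc 0 (2 * Real.pi), (1 / (1 - t)) ^ p * ∫ s in Ioc (0:ℝ) 1, F θ s := by
        refine integral_mono_of_nonneg (Eventually.of_forall fun _ => by positivity)
          (hFi.integral_prod_left.const_mul _) (Eventually.of_forall fun θ => ?_)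
        have h := norm_cesaro_rpow_le hp ht0 ht1 hf (mul_exp_mem_ball hr θ)
        rwa [intervalIntegral.integral_of_le zero_le_one] at h
    _ = (1 / (1 - t)) ^ p * ∫ s in Ioc (0:ℝ) 1, ∫ θ in Ioc 0 (2 * Real.pi), F θ s := by
        rw [integral_const_mul, integral_integral_swap hFi]
    _ ≤ (1 / (1 - t)) ^ p * ∫ _ in Ioc (0:ℝ) 1, 2 * Real.pi * M ^ p := by
        gcongr ?_ * ?_
        exact setIntegral_mono_on hFi.integral_prod_right (integrable_const _)
          measurableSet_Ioc hmean
    _ = 2 * Real.pi * ((1 / (1 - t)) ^ p * M ^ p) := by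
        simp
        ring

theorem Mp_zero {p : ℝ} (hp : 0 < p) (f : ℂ → ℂ) : Mp p 0 f = ‖f 0‖ := by
  have : Real.pi ≠ 0 := Real.pi_ne_zero
  have h : 1 / (2 * Real.pi) * (2 * Real.pi * ‖f 0‖ ^ p) = ‖f 0‖ ^ p := by field_simp
  simp only [Mp, ofReal_zero, zero_mul, intervalIntegral.integral_const, sub_zero, smul_eq_mul]
  rw [h, one_div, Real.rpow_rpow_inv (norm_nonneg _) hp.ne']

theorem Mp_one (p r : ℝ) : Mp p r (fun _ => 1) = 1 := by
  have h : 1 / (2 * Real.pi) * (2 * Real.pi) = 1 :=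
    one_div_mul_cancel (mul_ne_zero two_ne_zero Real.pi_ne_zero)
  simp only [Mp, norm_one, Real.one_rpow, intervalIntegral.integral_const, sub_zero, smul_eq_mul,
    mul_one, h]

theorem image_Mp_one (p : ℝ) : (fun r => Mp p r (fun _ => 1)) '' Ico (0:ℝ) 1 = {1} := by
  simp only [Mp_one]
  exact (nonempty_Ico.mpr one_pos).image_const 1

theorem MemHp.cesaro {p t : ℝ} (hp : 1 ≤ p) (ht0 : 0 ≤ t) (ht1 : t < 1) {f : ℂ → ℂ}
    (hf : MemHp p f) : MemHp p (cesaro t f) :=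
  ⟨differentiableOn_cesaro ht0 ht1 hf.1, (1 / (1 - t)) * hardyNorm p f,
    forall_mem_image.mpr fun _ hr =>
      Mp_cesaro_le hp ht0 ht1 hf.1.continuousOn (fun _ => Mp_le_hardyNorm hf) hr⟩

/-- For `1 ≤ p < ∞` and `t ∈ (0,1)`, the operator `C_t` maps `H^p` continuously into
itself with `‖C_t‖ ≤ 1/(1-t)`, and its operator norm is at least `1` (attained at a
normalized fixed vector). -/
theorem cesaro_continuous_Hp_norm_bounds (p t : ℝ) (hp : 1 ≤ p) (ht0 : 0 < t) (ht1 : t < 1) :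
    (∀ f, MemHp p f →
      MemHp p (cesaro t f) ∧ hardyNorm p (cesaro t f) ≤ (1 / (1 - t)) * hardyNorm p f) ∧
    (∃ f, MemHp p f ∧ hardyNorm p f = 1 ∧ 1 ≤ hardyNorm p (cesaro t f)) := by
  refine ⟨fun f hf => ⟨hf.cesaro hp ht0.le ht1, ?_⟩, fun _ => 1, ?_⟩
  · exact csSup_le ((nonempty_Ico.mpr one_pos).image _) (forall_mem_image.mpr fun _ hr =>
      Mp_cesaro_le hp ht0.le ht1 hf.1.continuousOn (fun _ => Mp_le_hardyNorm hf) hr)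
  · have h1 : MemHp p (fun _ => 1) :=
      ⟨differentiableOn_const 1, by rw [image_Mp_one]; exact bddAbove_singleton⟩
    refine ⟨h1, by rw [hardyNorm, image_Mp_one, csSup_singleton], ?_⟩
    have h := Mp_le_hardyNorm (h1.cesaro hp ht0.le ht1) (left_mem_Ico.mpr one_pos)
    rw [Mp_zero (by linarith)] at h
    simpa [cesaro] using h
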